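/- arXiv:1806.04701 — 2 statements merged into one kernel-verified Lean document; each statement's English description precedes it below -/
import Mathlib

section
/- For any Borel probability measure ρ on ℝ, the map ℝ^N → ℝ, x ↦ d_BL(ρ_n(x), ρ), is Lipschitz with Lipschitz constant N^{−1/2} with respect to the Euclidean norm on ℝ^N. -/
open MeasureTheory

noncomputable section

/-- The bounded Lipschitz distance `d_BL(μ,ν) = sup |∫f dμ − ∫f dν|`, the supremum running
over all `f : ℝ → ℝ` that are 1-Lipschitz and bounded by 1. -/
def dBL (μ ν : Measure ℝ) : ℝ :=
  ⨆ f : {g : ℝ → ℝ // LipschitzWith 1 g ∧ ∀ t, |g t| ≤ 1},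
    |(∫ t, f.1 t ∂μ) - ∫ t, f.1 t ∂ν|

open Matrix in
/-- The rows of a matrix `W` with `W * Wᴴ = 1` have unit norm. -/
theorem sum_normSq_row_eq_one {m : Type*} [Fintype m] [DecidableEq m] {W : Matrix m m ℂ}
    (hW : W * Wᴴ = 1) (i : m) : ∑ j, Complex.normSq (W i j) = 1 := by
  have h := congrFun (congrFun hW i) i
  simp only [mul_apply, conjTranspose_apply, one_apply_eq, RCLike.star_def,
    Complex.mul_conj] at h
  exact_mod_cast h

open Matrix in
theorem trace_mul_conjTranspose_eq_sum_normSq {m : Type*} [Fintype m] (M : Matrix m m ℂ) :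
    (M * Mᴴ).trace = ((∑ i, ∑ j, Complex.normSq (M i j) : ℝ) : ℂ) := by
  simp [trace, mul_apply, Complex.mul_conj]

open Matrix in
/-- The squared overlaps of the eigenvectors of two Hermitian matrices form a doubly stochastic
matrix, which couples the two spectra with quadratic cost `Tr (A - B)²`. -/
theorem exists_doublyStochastic_coupling {m : Type*} [Fintype m] [DecidableEq m]
    {A B : Matrix m m ℂ} (hA : A.IsHermitian) (hB : B.IsHermitian) :
    ∃ w : m → m → ℝ, (∀ i j, 0 ≤ w i j) ∧ (∀ i, ∑ j, w i j = 1) ∧ (∀ j, ∑ i, w i j = 1) ∧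
      ((∑ i, ∑ j, w i j * (hA.eigenvalues i - hB.eigenvalues j) ^ 2 : ℝ) : ℂ) =
        ((A - B) * (A - B)).trace := by
  set U : Matrix m m ℂ := hA.eigenvectorUnitary.1
  set V : Matrix m m ℂ := hB.eigenvectorUnitary.1
  have hUU : Uᴴ * U = 1 := Unitary.coe_star_mul_self hA.eigenvectorUnitary
  have hUU' : U * Uᴴ = 1 := Unitary.coe_mul_star_self hA.eigenvectorUnitary
  have hVV : Vᴴ * V = 1 := Unitary.coe_star_mul_self hB.eigenvectorUnitary
  have hVV' : V * Vᴴ = 1 := Unitary.coe_mul_star_self hB.eigenvectorUnitary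
  set D : Matrix m m ℂ := diagonal (RCLike.ofReal ∘ hA.eigenvalues) with hD
  set E : Matrix m m ℂ := diagonal (RCLike.ofReal ∘ hB.eigenvalues) with hE
  have hAD : A = U * D * Uᴴ := hA.spectral_theorem
  have hBE : B = V * E * Vᴴ := hB.spectral_theorem
  set W : Matrix m m ℂ := Uᴴ * V with hW
  have hWW : W * Wᴴ = 1 := by
    rw [hW, conjTranspose_mul, conjTranspose_conjTranspose, Matrix.mul_assoc,
      ← Matrix.mul_assoc V, hVV', Matrix.one_mul, hUU]
  have hWW' : Wᴴ * Wᴴᴴ = 1 := by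
    rw [conjTranspose_conjTranspose, hW, conjTranspose_mul, conjTranspose_conjTranspose,
      Matrix.mul_assoc, ← Matrix.mul_assoc U, hUU', Matrix.one_mul, hVV]
  have hM : Uᴴ * (A - B) * V = D * W - W * E := by
    have hUA : Uᴴ * A = D * Uᴴ := by
      rw [hAD, ← Matrix.mul_assoc, ← Matrix.mul_assoc, hUU, Matrix.one_mul]
    have hBV : B * V = V * E := by
      rw [hBE, Matrix.mul_assoc, hVV, Matrix.mul_one]
    rw [Matrix.mul_sub, Matrix.sub_mul, hUA, Matrix.mul_assoc Uᴴ B, hBV, hW,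
      Matrix.mul_assoc, Matrix.mul_assoc]
  have htrace : (D * W - W * E) * (D * W - W * E)ᴴ = Uᴴ * ((A - B) * (A - B)) * U := by
    rw [← hM, conjTranspose_mul, conjTranspose_mul, conjTranspose_conjTranspose,
      (hA.sub hB).eq]
    calc Uᴴ * (A - B) * V * (Vᴴ * ((A - B) * U))
        = Uᴴ * (A - B) * (V * Vᴴ) * ((A - B) * U) := by simp only [Matrix.mul_assoc]
      _ = _ := by rw [hVV', Matrix.mul_one]; simp only [Matrix.mul_assoc]
  refine ⟨fun i j ↦ Complex.normSq (W i j), fun i j ↦ Complex.normSq_nonneg _,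
    sum_normSq_row_eq_one hWW, fun j ↦ ?_, ?_⟩
  · simpa [conjTranspose_apply] using sum_normSq_row_eq_one hWW' j
  · have htr := congrArg trace htrace
    rw [trace_mul_conjTranspose_eq_sum_normSq, Matrix.trace_mul_comm,
      ← Matrix.mul_assoc U, hUU',
      Matrix.one_mul] at htr
    rw [← htr]
    congr 1
    refine Finset.sum_congr rfl fun i _ ↦ Finset.sum_congr rfl fun j _ ↦ ?_
    have : (D * W - W * E) i j
        = ((hA.eigenvalues i - hB.eigenvalues j : ℝ) : ℂ) * W i j := by
      simp [hD, hE, sub_mul, mul_comm]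
    rw [this, Complex.normSq_mul, Complex.normSq_ofReal]
    ring

/-- Linear statistics of the spectrum, for a 1-Lipschitz function, are Lipschitz in the
Hilbert–Schmidt norm. -/
theorem sq_sum_eigenvalues_sub_le {m : Type*} [Fintype m] [DecidableEq m]
    {A B : Matrix m m ℂ} (hA : A.IsHermitian) (hB : B.IsHermitian) {f : ℝ → ℝ}
    (hf : LipschitzWith 1 f) :
    (∑ i, f (hA.eigenvalues i) - ∑ i, f (hB.eigenvalues i)) ^ 2 ≤
      Fintype.card m * (((A - B) * (A - B)).trace).re := by
  obtain ⟨w, hw, hrow, hcol, hcost⟩ := exists_doublyStochastic_coupling hA hB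
  have hsum : ∑ i, f (hA.eigenvalues i) - ∑ i, f (hB.eigenvalues i)
      = ∑ p : m × m, w p.1 p.2 * (f (hA.eigenvalues p.1) - f (hB.eigenvalues p.2)) := by
    simp only [mul_sub, Finset.sum_sub_distrib]
    congr 1
    · rw [Fintype.sum_prod_type]
      simp [← Finset.sum_mul, hrow]
    · rw [Fintype.sum_prod_type_right]
      simp [← Finset.sum_mul, hcol]
  rw [hsum, ← hcost, Complex.ofReal_re]
  have hcard : (Fintype.card m : ℝ) = ∑ p : m × m, w p.1 p.2 := by
    rw [Fintype.sum_prod_type]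
    simp [hrow]
  rw [hcard, ← Fintype.sum_prod_type'
    (f := fun i j ↦ w i j * (hA.eigenvalues i - hB.eigenvalues j) ^ 2)]
  refine Finset.sum_sq_le_sum_mul_sum_of_sq_le_mul _ (fun p _ ↦ hw _ _)
    (fun p _ ↦ mul_nonneg (hw _ _) (sq_nonneg _)) fun p _ ↦ ?_
  have hfp : (f (hA.eigenvalues p.1) - f (hB.eigenvalues p.2)) ^ 2
      ≤ (hA.eigenvalues p.1 - hB.eigenvalues p.2) ^ 2 := by
    rw [sq_le_sq]
    simpa [Real.dist_eq] using hf.dist_le_mul (hA.eigenvalues p.1) (hB.eigenvalues p.2)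
  calc _ = w p.1 p.2 ^ 2 * (f (hA.eigenvalues p.1) - f (hB.eigenvalues p.2)) ^ 2 := by ring
    _ ≤ w p.1 p.2 ^ 2 * (hA.eigenvalues p.1 - hB.eigenvalues p.2) ^ 2 := by gcongr
    _ = _ := by ring

/-- A uniform bound on the differences of integrals of test functions bounds the variation of
the bounded Lipschitz distance to a fixed probability measure. -/
theorem abs_dBL_sub_dBL_le {μ ν ρ : Measure ℝ} [IsProbabilityMeasure μ] [IsProbabilityMeasure ν]
    [IsProbabilityMeasure ρ] {C : ℝ}
    (h : ∀ f : ℝ → ℝ, LipschitzWith 1 f → |(∫ t, f t ∂μ) - ∫ t, f t ∂ν| ≤ C) :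
    |dBL μ ρ - dBL ν ρ| ≤ C := by
  have key : ∀ (μ ν : Measure ℝ) [IsProbabilityMeasure μ] [IsProbabilityMeasure ν],
      (∀ f : ℝ → ℝ, LipschitzWith 1 f → |(∫ t, f t ∂μ) - ∫ t, f t ∂ν| ≤ C) →
      dBL μ ρ ≤ C + dBL ν ρ := by
    intro μ ν _ _ h
    have hint : ∀ (τ : Measure ℝ) [IsProbabilityMeasure τ] (f : ℝ → ℝ), (∀ t, |f t| ≤ 1) →
        |∫ t, f t ∂τ| ≤ 1 := fun τ _ f hf ↦ by
      simpa using norm_integral_le_of_norm_le_const (μ := τ) (f := f) (C := 1)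
        (Filter.Eventually.of_forall hf)
    have : Nonempty {g : ℝ → ℝ // LipschitzWith 1 g ∧ ∀ t, |g t| ≤ 1} :=
      ⟨⟨fun _ ↦ 0, LipschitzWith.const' 0, by simp⟩⟩
    refine ciSup_le fun f ↦ ?_
    have hbdd : BddAbove (Set.range fun g : {g : ℝ → ℝ // LipschitzWith 1 g ∧ ∀ t, |g t| ≤ 1} ↦
        |(∫ t, g.1 t ∂ν) - ∫ t, g.1 t ∂ρ|) := by
      refine ⟨1 + 1, ?_⟩
      rintro _ ⟨g, rfl⟩
      exact (abs_sub _ _).trans (add_le_add (hint ν _ g.2.2) (hint ρ _ g.2.2))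
    exact (abs_sub_le _ (∫ t, f.1 t ∂ν) _).trans
      (add_le_add (h f.1 f.2.1) (le_ciSup hbdd f))
  rw [abs_sub_le_iff]
  have h₁ := key μ ν h
  have h₂ := key ν μ fun f hf ↦ by rw [abs_sub_comm]; exact h f hf
  constructor <;> linarith

theorem integral_uniform_dirac {L : ℕ} (a : Fin L → ℝ) (f : ℝ → ℝ) :
    ∫ t, f t ∂((L : ENNReal)⁻¹ • ∑ i, Measure.dirac (a i)) = (L : ℝ)⁻¹ * ∑ i, f (a i) := by
  rw [integral_smul_measure, integral_finsetSum_measure fun i _ ↦ integrable_dirac (by simp)]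
  simp

theorem isProbabilityMeasure_uniform_dirac {L : ℕ} (hL : L ≠ 0) (a : Fin L → ℝ) :
    IsProbabilityMeasure ((L : ENNReal)⁻¹ • ∑ i, Measure.dirac (a i)) :=
  ⟨by simpa using ENNReal.inv_mul_cancel (by simpa using hL) (ENNReal.natCast_ne_top L)⟩

/-- The Hilbert–Schmidt norm of a real combination of an orthogonal family. -/
theorem trace_sq_sum_smul {ι m : Type*} [Fintype ι] [DecidableEq ι] [Fintype m]
    {A : ι → Matrix m m ℂ} {c : ℂ}
    (htr : ∀ R R', (A R * A R').trace = if R = R' then c else 0) (z : ι → ℂ) :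
    ((∑ R, z R • A R) * ∑ R, z R • A R).trace = c * ∑ R, z R ^ 2 := by
  simp only [Finset.sum_mul, Finset.mul_sum, Matrix.trace_sum, Matrix.smul_mul, Matrix.mul_smul,
    Matrix.trace_smul, htr, smul_eq_mul]
  simp only [mul_ite, mul_zero, Finset.sum_ite_eq', Finset.mem_univ, if_true]
  exact Finset.sum_congr rfl fun R _ ↦ by ring

theorem stmt3 {ι : Type*} [Fintype ι] [DecidableEq ι]
    (n q L N : ℕ) (hn : Even n) (hq0 : 0 < q) (hq : q ≤ n / 2)
    (hL : L = 2 ^ (n / 2)) (hN : N = n.choose q) (hcard : Fintype.card ι = N)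
    (A : ι → Matrix (Fin L) (Fin L) ℂ)
    (hA : ∀ R, (A R).IsHermitian)
    (htr : ∀ R R', ((A R) * (A R')).trace = if R = R' then (L : ℂ) else 0)
    (H : EuclideanSpace ℝ ι → Matrix (Fin L) (Fin L) ℂ)
    (hH : ∀ x, H x = ((Real.sqrt N : ℂ))⁻¹ • ∑ R, (x R : ℂ) • A R)
    (hHerm : ∀ x, (H x).IsHermitian)
    (ρ : Measure ℝ) (hρ : IsProbabilityMeasure ρ) :
    ∀ x y : EuclideanSpace ℝ ι,
      |dBL ((L : ENNReal)⁻¹ • ∑ i, Measure.dirac ((hHerm x).eigenvalues i)) ρ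
        - dBL ((L : ENNReal)⁻¹ • ∑ i, Measure.dirac ((hHerm y).eigenvalues i)) ρ|
      ≤ (Real.sqrt N)⁻¹ * dist x y := by
  intro x y
  have hL0 : L ≠ 0 := by rw [hL]; positivity
  have hLpos : (0 : ℝ) < L := by positivity
  have := isProbabilityMeasure_uniform_dirac hL0 (hHerm x).eigenvalues
  have := isProbabilityMeasure_uniform_dirac hL0 (hHerm y).eigenvalues
  refine abs_dBL_sub_dBL_le fun f hf ↦ ?_
  have htrace : (((H x - H y) * (H x - H y)).trace).re
      = L * ((Real.sqrt N)⁻¹ * dist x y) ^ 2 := by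
    have hsub : H x - H y
        = ∑ R, (((Real.sqrt N)⁻¹ * (x R - y R) : ℝ) : ℂ) • A R := by
      rw [hH, hH, ← smul_sub, ← Finset.sum_sub_distrib, Finset.smul_sum]
      refine Finset.sum_congr rfl fun R _ ↦ ?_
      rw [← sub_smul, smul_smul]
      push_cast
      rfl
    have hdist : dist x y ^ 2 = ∑ R, (x R - y R) ^ 2 := by
      rw [EuclideanSpace.dist_eq, Real.sq_sqrt (by positivity)]
      simp [Real.dist_eq]
    rw [hsub, trace_sq_sum_smul htr, mul_pow, hdist]
    norm_cast
    simp only [mul_pow, Finset.mul_sum]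
  have hsq := sq_sum_eigenvalues_sub_le (hHerm x) (hHerm y) hf
  rw [htrace, Fintype.card_fin] at hsq
  rw [integral_uniform_dirac, integral_uniform_dirac, ← mul_sub]
  refine abs_le_of_sq_le_sq ?_ (by positivity)
  rw [mul_pow, inv_pow, inv_mul_le_iff₀ (by positivity)]
  exact hsq.trans_eq (by ring)
end
end

section
/- Let n be a positive even integer and let 0 < a < 1 < b. Then ∫_{Σ_{n,a,b}} |Δ(μ)|² e^{−Σ_{j=1}^{n/2} μ_j²/2} dμ ≥ Z_n (1 − (a e^{1−a})^{n(n−1)/4} − (b e^{1−b})^{n(n−1)/4}). -/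
open MeasureTheory

noncomputable section

/-- The open Weyl chamber `Σ_n`: strictly decreasing positive vectors. -/
def SigmaN (m : ℕ) : Set (Fin m → ℝ) :=
  {μ | (∀ i j : Fin m, i < j → μ j < μ i) ∧ ∀ i, 0 < μ i}

/-- The Vandermonde-type determinant `Δ(μ) = ∏_{i<j} (μ_i² − μ_j²)`. -/
def VdM (m : ℕ) (μ : Fin m → ℝ) : ℝ :=
  ∏ p ∈ Finset.univ.filter (fun p : Fin m × Fin m => p.1 < p.2), (μ p.1 ^ 2 - μ p.2 ^ 2)

/-- The normalization constant `Z_n = (π/2)^{n/4} ∏_{j=0}^{n/2−1} (2j)!`. -/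
def Zn (n : ℕ) : ℝ :=
  (Real.pi / 2) ^ ((n : ℝ) / 4) * ∏ j ∈ Finset.range (n / 2), (Nat.factorial (2 * j) : ℝ)


open Polynomial in
theorem integrable_polynomial_mul_exp_neg_sq_div_two (p : ℝ[X]) :
    Integrable fun x : ℝ => p.eval x * Real.exp (-x ^ 2 / 2) := by
  induction p using Polynomial.induction_on' with
  | add p q hp hq =>
    simp only [eval_add, add_mul]
    exact hp.add hq
  | monomial k c =>
    have h := (integrable_rpow_mul_exp_neg_mul_sq (b := 1 / 2) (by norm_num)
      (s := (k : ℝ)) (by linarith [k.cast_nonneg (α := ℝ)])).const_mul c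
    refine h.congr (ae_of_all _ fun x => ?_)
    simp only [Real.rpow_natCast, eval_monomial]
    rw [show -(1 / 2) * x ^ 2 = -x ^ 2 / 2 by ring, mul_assoc]

open Polynomial in
/-- Integration by parts against the Gaussian weight. -/
theorem integral_X_mul_polynomial_mul_exp_neg_sq_div_two (p : ℝ[X]) :
    ∫ x : ℝ, (X * p).eval x * Real.exp (-x ^ 2 / 2) =
      ∫ x : ℝ, (derivative p).eval x * Real.exp (-x ^ 2 / 2) := by
  have hderiv : ∀ x : ℝ, HasDerivAt (fun x => p.eval x * Real.exp (-x ^ 2 / 2))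
      ((derivative p).eval x * Real.exp (-x ^ 2 / 2) -
        (X * p).eval x * Real.exp (-x ^ 2 / 2)) x := by
    intro x
    have he : HasDerivAt (fun x : ℝ => -x ^ 2 / 2) (-x) x := by
      refine ((hasDerivAt_pow 2 x).neg.div_const 2).congr_deriv ?_
      norm_num
      ring
    refine ((p.hasDerivAt x).mul he.exp).congr_deriv ?_
    rw [eval_mul, eval_X]
    ring
  have h := integral_eq_zero_of_hasDerivAt_of_integrable hderiv
    ((integrable_polynomial_mul_exp_neg_sq_div_two _).sub
      (integrable_polynomial_mul_exp_neg_sq_div_two _))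
    (integrable_polynomial_mul_exp_neg_sq_div_two _)
  rw [integral_sub (integrable_polynomial_mul_exp_neg_sq_div_two _)
    (integrable_polynomial_mul_exp_neg_sq_div_two _)] at h
  linarith

open Polynomial in
theorem integral_mul_hermite_mul_exp_neg_sq_div_two (k : ℕ) (p : ℝ[X]) :
    ∫ x : ℝ, (p * (hermite k).map (Int.castRingHom ℝ)).eval x * Real.exp (-x ^ 2 / 2) =
      ∫ x : ℝ, (derivative^[k] p).eval x * Real.exp (-x ^ 2 / 2) := by
  induction k generalizing p with
  | zero => simp
  | succ k ih =>
    rw [Function.iterate_succ_apply, ← ih]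
    set H := (hermite k).map (Int.castRingHom ℝ) with hH
    have h1 : p * (hermite (k + 1)).map (Int.castRingHom ℝ) =
        X * (p * H) - p * derivative H := by
      rw [hermite_succ, Polynomial.map_sub, Polynomial.map_mul, map_X, ← derivative_map, ← hH]
      ring
    have h2 := integral_X_mul_polynomial_mul_exp_neg_sq_div_two (p * H)
    rw [derivative_mul] at h2
    simp only [h1, eval_sub, sub_mul]
    rw [integral_sub (integrable_polynomial_mul_exp_neg_sq_div_two _)
      (integrable_polynomial_mul_exp_neg_sq_div_two _), h2]
    simp only [eval_add, add_mul]
    rw [integral_add (integrable_polynomial_mul_exp_neg_sq_div_two _)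
      (integrable_polynomial_mul_exp_neg_sq_div_two _)]
    ring

open Polynomial in
theorem integral_hermite_mul_hermite_of_lt {j k : ℕ} (h : j < k) :
    ∫ x : ℝ, ((hermite j).map (Int.castRingHom ℝ) *
      (hermite k).map (Int.castRingHom ℝ)).eval x * Real.exp (-x ^ 2 / 2) = 0 := by
  rw [integral_mul_hermite_mul_exp_neg_sq_div_two, iterate_derivative_eq_zero]
  · simp
  · rwa [(hermite_monic j).natDegree_map, natDegree_hermite]

open Polynomial in
theorem integral_hermite_mul_hermite (j k : ℕ) :
    ∫ x : ℝ, ((hermite j).map (Int.castRingHom ℝ) *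
      (hermite k).map (Int.castRingHom ℝ)).eval x * Real.exp (-x ^ 2 / 2) =
      if j = k then √(2 * Real.pi) * (k.factorial : ℝ) else 0 := by
  rcases lt_trichotomy j k with h | rfl | h
  · rw [if_neg h.ne, integral_hermite_mul_hermite_of_lt h]
  · rw [if_pos rfl, integral_mul_hermite_mul_exp_neg_sq_div_two]
    have hd : derivative^[j] ((hermite j).map (Int.castRingHom ℝ)) = C (j.factorial : ℝ) := by
      rw [eq_C_of_natDegree_eq_zero (p := derivative^[j] _), coeff_iterate_derivative]
      · simp [Nat.descFactorial_self]
      · have := natDegree_iterate_derivative ((hermite j).map (Int.castRingHom ℝ)) j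
        rw [(hermite_monic j).natDegree_map, natDegree_hermite] at this
        omega
    have hg := integral_gaussian (1 / 2)
    simp only [hd, eval_C]
    rw [integral_const_mul, mul_comm, show (2 * Real.pi) = Real.pi / (1 / 2) by ring, ← hg]
    congr 2
    ext x
    ring_nf
  · rw [if_neg h.ne', mul_comm, integral_hermite_mul_hermite_of_lt h]

open Polynomial in
/-- The monic polynomial `Q` of degree `j` with `Q(x²)` the Hermite polynomial of degree `2j`. -/
def evenHermite (j : ℕ) : ℝ[X] := contract 2 ((hermite (2 * j)).map (Int.castRingHom ℝ))

open Polynomial in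
theorem evenHermite_coeff (j k : ℕ) :
    (evenHermite j).coeff k = ((hermite (2 * j)).coeff (2 * k) : ℝ) := by
  rw [evenHermite, coeff_contract two_ne_zero, coeff_map, mul_comm k]
  rfl

open Polynomial in
theorem evenHermite_natDegree (j : ℕ) : (evenHermite j).natDegree = j := by
  refine natDegree_eq_of_le_of_coeff_ne_zero ?_ (by simp [evenHermite_coeff])
  refine natDegree_le_iff_coeff_eq_zero.2 fun k hk => ?_
  rw [evenHermite_coeff, coeff_hermite_of_lt (by omega), Int.cast_zero]

open Polynomial in
theorem evenHermite_monic (j : ℕ) : (evenHermite j).Monic := by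
  rw [Monic, leadingCoeff, evenHermite_natDegree, evenHermite_coeff, coeff_hermite_self,
    Int.cast_one]

open Polynomial in
theorem evenHermite_eval_sq (j : ℕ) (x : ℝ) :
    (evenHermite j).eval (x ^ 2) = ((hermite (2 * j)).map (Int.castRingHom ℝ)).eval x := by
  rw [← expand_eval]
  congr 1
  ext k
  rw [coeff_expand two_pos, coeff_map]
  split_ifs with h
  · obtain ⟨l, rfl⟩ := h
    rw [Nat.mul_div_cancel_left _ two_pos, evenHermite_coeff]
    rfl
  · rw [coeff_hermite_of_odd_add, map_zero]
    grind

open Polynomial in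
theorem integral_Ioi_evenHermite_mul_evenHermite (j k : ℕ) :
    ∫ x in Set.Ioi (0 : ℝ), (evenHermite j).eval (x ^ 2) * (evenHermite k).eval (x ^ 2) *
      Real.exp (-x ^ 2 / 2) =
      if j = k then √(Real.pi / 2) * ((2 * k).factorial : ℝ) else 0 := by
  have h := integral_comp_abs (f := fun x => (evenHermite j).eval (x ^ 2) *
    (evenHermite k).eval (x ^ 2) * Real.exp (-x ^ 2 / 2))
  have h' := integral_hermite_mul_hermite (2 * j) (2 * k)
  simp only [sq_abs] at h
  simp only [eval_mul, ← evenHermite_eval_sq] at h'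
  rw [h'] at h
  have hs : √(2 * Real.pi) = 2 * √(Real.pi / 2) := by
    rw [show 2 * Real.pi = 2 ^ 2 * (Real.pi / 2) by ring, Real.sqrt_mul (by norm_num),
      Real.sqrt_sq (by norm_num)]
  simp only [mul_right_inj' two_ne_zero, hs] at h
  split_ifs at h ⊢ <;> linarith

open Polynomial in
theorem integrable_evenHermite_mul_evenHermite (j k : ℕ) :
    Integrable fun x : ℝ => (evenHermite j).eval (x ^ 2) * (evenHermite k).eval (x ^ 2) *
      Real.exp (-x ^ 2 / 2) := by
  simp only [evenHermite_eval_sq, ← eval_mul]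
  exact integrable_polynomial_mul_exp_neg_sq_div_two _

/-- Andréief's identity for a weighted orthogonal family. -/
theorem integrable_and_integral_det_sq_of_orthogonal {m : ℕ} (ν : Measure ℝ) [SigmaFinite ν]
    (f : Fin m → ℝ → ℝ) (w : ℝ → ℝ) (h : Fin m → ℝ)
    (hint : ∀ j k, Integrable (fun x => f j x * f k x * w x) ν)
    (horth : ∀ j k, ∫ x, f j x * f k x * w x ∂ν = if j = k then h k else 0) :
    Integrable (fun x : Fin m → ℝ =>
      (Matrix.of fun i j => f j (x i)).det ^ 2 * ∏ i, w (x i)) (Measure.pi fun _ => ν) ∧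
    ∫ x : Fin m → ℝ, (Matrix.of fun i j => f j (x i)).det ^ 2 * ∏ i, w (x i)
      ∂(Measure.pi fun _ => ν) = (m.factorial : ℝ) * ∏ j, h j := by
  have hexp : ∀ x : Fin m → ℝ,
      (Matrix.of fun i j => f j (x i)).det ^ 2 * ∏ i, w (x i) =
        ∑ σ : Equiv.Perm (Fin m), ∑ τ : Equiv.Perm (Fin m),
          ((Equiv.Perm.sign σ : ℤ) : ℝ) * ((Equiv.Perm.sign τ : ℤ) : ℝ) *
            ∏ i, (f (σ i) (x i) * f (τ i) (x i) * w (x i)) := by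
    intro x
    rw [← Matrix.det_transpose, Matrix.det_apply', sq, Finset.sum_mul_sum, Finset.sum_mul]
    refine Finset.sum_congr rfl fun σ _ => ?_
    rw [Finset.sum_mul]
    refine Finset.sum_congr rfl fun τ _ => ?_
    simp only [Matrix.transpose_apply, Matrix.of_apply, Finset.prod_mul_distrib]
    ring
  have hterm : ∀ σ τ : Equiv.Perm (Fin m), Integrable (fun x : Fin m → ℝ =>
      ((Equiv.Perm.sign σ : ℤ) : ℝ) * ((Equiv.Perm.sign τ : ℤ) : ℝ) *
        ∏ i, (f (σ i) (x i) * f (τ i) (x i) * w (x i))) (Measure.pi fun _ => ν) :=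
    fun σ τ => (Integrable.fintype_prod (f := fun i y => f (σ i) y * f (τ i) y * w y)
      fun i => hint (σ i) (τ i)).const_mul _
  simp only [hexp]
  refine ⟨integrable_finsetSum _ fun σ _ => integrable_finsetSum _ fun τ _ => hterm σ τ, ?_⟩
  rw [integral_finsetSum _ fun σ _ => integrable_finsetSum _ fun τ _ => hterm σ τ]
  have hσ : ∀ σ : Equiv.Perm (Fin m), ∫ x : Fin m → ℝ, ∑ τ : Equiv.Perm (Fin m),
      ((Equiv.Perm.sign σ : ℤ) : ℝ) * ((Equiv.Perm.sign τ : ℤ) : ℝ) *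
        ∏ i, (f (σ i) (x i) * f (τ i) (x i) * w (x i)) ∂(Measure.pi fun _ => ν) =
      ∏ j, h j := by
    intro σ
    rw [integral_finsetSum _ fun τ _ => hterm σ τ, Finset.sum_eq_single σ]
    · rw [integral_const_mul, integral_fintype_prod_eq_prod
        (fun i y => f (σ i) y * f (σ i) y * w y)]
      simp only [horth, if_true]
      rw [Equiv.prod_comp σ h, ← Int.cast_mul, ← Units.val_mul, Int.units_mul_self]
      simp
    · intro τ _ hτ
      obtain ⟨i, hi⟩ : ∃ i, σ i ≠ τ i := by
        by_contra! hall
        exact hτ (Equiv.ext fun i => (hall i).symm)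
      rw [integral_const_mul, integral_fintype_prod_eq_prod
        (fun i y => f (σ i) y * f (τ i) y * w y), Finset.prod_eq_zero (Finset.mem_univ i),
        mul_zero]
      rw [horth, if_neg hi]
    · simp
  simp [hσ, Fintype.card_perm]

theorem VdM_sq_eq_det_vandermonde_sq (m : ℕ) (μ : Fin m → ℝ) :
    VdM m μ ^ 2 = (Matrix.vandermonde fun i => μ i ^ 2).det ^ 2 := by
  rw [VdM, Matrix.det_vandermonde, Finset.prod_filter, ← Finset.univ_product_univ,
    Finset.prod_product, ← Finset.prod_pow, ← Finset.prod_pow]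
  refine Finset.prod_congr rfl fun i _ => ?_
  rw [← Finset.prod_filter, Finset.filter_lt_eq_Ioi, ← Finset.prod_pow, ← Finset.prod_pow]
  exact Finset.prod_congr rfl fun j _ => sub_sq_comm _ _

theorem VdM_sq_comp_perm (m : ℕ) (μ : Fin m → ℝ) (σ : Equiv.Perm (Fin m)) :
    VdM m (μ ∘ σ) ^ 2 = VdM m μ ^ 2 := by
  have h : (Matrix.vandermonde fun i => (μ ∘ σ) i ^ 2) =
      (Matrix.vandermonde fun i => μ i ^ 2).submatrix σ id := rfl
  rw [VdM_sq_eq_det_vandermonde_sq, VdM_sq_eq_det_vandermonde_sq, h, Matrix.det_permute, mul_pow,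
    ← Int.cast_pow, ← Units.val_pow_eq_pow_val, Int.units_sq]
  simp

theorem VdM_eq_zero_of_not_injective {m : ℕ} {μ : Fin m → ℝ} (h : ¬ Function.Injective μ) :
    VdM m μ = 0 := by
  rw [← sq_eq_zero_iff, VdM_sq_eq_det_vandermonde_sq, sq_eq_zero_iff,
    Matrix.det_vandermonde_eq_zero_iff]
  obtain ⟨i, j, hij, hne⟩ := Function.not_injective_iff.1 h
  exact ⟨i, j, by simp [hij], hne⟩

theorem isOpen_SigmaN (m : ℕ) : IsOpen (SigmaN m) := by
  simp only [SigmaN, Set.ofPred_and, Set.ofPred_forall]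
  exact (isOpen_iInter_of_finite fun i => isOpen_iInter_of_finite fun j =>
    isOpen_iInter_of_finite fun _ => isOpen_lt (by fun_prop) (by fun_prop)).inter
    (isOpen_iInter_of_finite fun i => isOpen_lt (by fun_prop) (by fun_prop))

theorem exists_perm_comp_mem_SigmaN {m : ℕ} {x : Fin m → ℝ} (hx : ∀ i, 0 < x i)
    (hinj : Function.Injective x) : ∃ σ : Equiv.Perm (Fin m), x ∘ σ ∈ SigmaN m := by
  refine ⟨Tuple.sort fun i => -x i, fun i j hij => ?_, fun i => hx _⟩
  have h := Tuple.monotone_sort (fun i => -x i) hij.le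
  simp only [Function.comp_apply, neg_le_neg_iff] at h
  refine lt_of_le_of_ne h fun he => ?_
  exact hij.ne' (Equiv.injective _ (hinj he))

theorem perm_eq_of_comp_mem_SigmaN {m : ℕ} {x : Fin m → ℝ} {σ τ : Equiv.Perm (Fin m)}
    (hσ : x ∘ σ ∈ SigmaN m) (hτ : x ∘ τ ∈ SigmaN m) : σ = τ := by
  have hmono : ∀ ρ : Equiv.Perm (Fin m), x ∘ ρ ∈ SigmaN m →
      StrictMono ((fun i => -x i) ∘ ρ) := fun ρ h i j hij => neg_lt_neg (h.1 i j hij)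
  have he := Tuple.unique_monotone (hmono σ hσ).monotone (hmono τ hτ).monotone
  have hinj : Function.Injective fun i => -x i :=
    (Equiv.injective_comp σ _).1 (hmono σ hσ).injective
  exact Equiv.ext fun i => hinj (congrFun he i)

/-- A symmetric function supported on injective vectors integrates over the positive orthant to
`m!` times its integral over the Weyl chamber. -/
theorem setIntegral_orthant_eq_factorial_mul {m : ℕ} (g : (Fin m → ℝ) → ℝ)
    (hsymm : ∀ x (σ : Equiv.Perm (Fin m)), g (x ∘ σ) = g x)
    (hzero : ∀ x, ¬ Function.Injective x → g x = 0)
    (hint : IntegrableOn g (Set.univ.pi fun _ => Set.Ioi 0)) :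
    ∫ x in Set.univ.pi fun _ => Set.Ioi 0, g x = (m.factorial : ℝ) * ∫ x in SigmaN m, g x := by
  have hcomp : ∀ σ : Equiv.Perm (Fin m),
      (MeasurableEquiv.piCongrLeft (fun _ : Fin m => ℝ) σ.symm : (Fin m → ℝ) → Fin m → ℝ) =
        fun x => x ∘ σ := by
    intro σ
    ext x i
    obtain ⟨j, rfl⟩ := σ.symm.surjective i
    rw [MeasurableEquiv.piCongrLeft_apply_apply]
    simp
  have hmp : ∀ σ : Equiv.Perm (Fin m), MeasurePreserving (fun x : Fin m → ℝ => x ∘ σ) :=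
    fun σ => hcomp σ ▸ volume_measurePreserving_piCongrLeft (fun _ : Fin m => ℝ) σ.symm
  have hemb : ∀ σ : Equiv.Perm (Fin m), MeasurableEmbedding fun x : Fin m → ℝ => x ∘ σ :=
    fun σ => hcomp σ ▸ MeasurableEquiv.measurableEmbedding _
  set A : Equiv.Perm (Fin m) → Set (Fin m → ℝ) := fun σ => (fun x => x ∘ σ) ⁻¹' SigmaN m
  have hAmeas : ∀ σ, MeasurableSet (A σ) :=
    fun σ => (hmp σ).measurable (isOpen_SigmaN m).measurableSet
  have hAsub : ∀ σ, A σ ⊆ Set.univ.pi fun _ => Set.Ioi 0 := by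
    intro σ x hx i _
    have := hx.2 (σ.symm i)
    simpa using this
  have hunion : ∫ x in Set.univ.pi fun _ => Set.Ioi 0, g x = ∫ x in ⋃ σ, A σ, g x := by
    refine setIntegral_eq_of_subset_of_forall_sdiff_eq_zero
      (MeasurableSet.univ_pi fun _ => measurableSet_Ioi) (Set.iUnion_subset hAsub) ?_
    rintro x ⟨hx, hx'⟩
    refine hzero x fun hinj => hx' ?_
    exact Set.mem_iUnion.2 (exists_perm_comp_mem_SigmaN (fun i => hx i (Set.mem_univ i)) hinj)
  rw [hunion, integral_iUnion_fintype hAmeas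
    (fun σ τ hne => Set.disjoint_left.2 fun x hx hx' => hne (perm_eq_of_comp_mem_SigmaN hx hx'))
    fun σ => hint.mono_set (hAsub σ)]
  have hone : ∀ σ, ∫ x in A σ, g x = ∫ x in SigmaN m, g x := by
    intro σ
    have h := (hmp σ).setIntegral_preimage_emb (hemb σ) g (SigmaN m)
    simpa only [hsymm] using h
  simp [hone, Fintype.card_perm]

theorem SigmaN_subset_orthant (m : ℕ) : SigmaN m ⊆ Set.univ.pi fun _ => Set.Ioi 0 :=
  fun _ hx i _ => hx.2 i

theorem VdM_sq_mul_exp_eq (m : ℕ) (μ : Fin m → ℝ) :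
    VdM m μ ^ 2 * Real.exp (-(∑ j, μ j ^ 2) / 2) =
      (Matrix.of fun i j : Fin m => (evenHermite j).eval (μ i ^ 2)).det ^ 2 *
        ∏ i, Real.exp (-μ i ^ 2 / 2) := by
  rw [VdM_sq_eq_det_vandermonde_sq, Matrix.det_eval_matrixOfPolynomials_eq_det_vandermonde _
    (fun j : Fin m => evenHermite j) (fun j => evenHermite_natDegree j)
    (fun j => evenHermite_monic j), ← Real.exp_sum, ← Finset.sum_div, Finset.sum_neg_distrib]

theorem integrableOn_and_setIntegral_orthant (m : ℕ) :
    IntegrableOn (fun μ : Fin m → ℝ => VdM m μ ^ 2 * Real.exp (-(∑ j, μ j ^ 2) / 2))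
      (Set.univ.pi fun _ => Set.Ioi 0) ∧
    ∫ μ in Set.univ.pi fun _ => Set.Ioi 0, VdM m μ ^ 2 * Real.exp (-(∑ j, μ j ^ 2) / 2) =
      (m.factorial : ℝ) * ∏ j : Fin m, (√(Real.pi / 2) * ((2 * (j : ℕ)).factorial : ℝ)) := by
  simp only [VdM_sq_mul_exp_eq, IntegrableOn, volume_pi, Measure.restrict_pi_pi]
  exact integrable_and_integral_det_sq_of_orthogonal (volume.restrict (Set.Ioi 0))
    (fun (j : Fin m) x => (evenHermite j).eval (x ^ 2)) (fun x => Real.exp (-x ^ 2 / 2)) _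
    (fun j k => (integrable_evenHermite_mul_evenHermite j k).integrableOn)
    fun j k => by simp only [integral_Ioi_evenHermite_mul_evenHermite, Fin.val_inj]

theorem integrableOn_SigmaN (m : ℕ) :
    IntegrableOn (fun μ : Fin m → ℝ => VdM m μ ^ 2 * Real.exp (-(∑ j, μ j ^ 2) / 2))
      (SigmaN m) :=
  (integrableOn_and_setIntegral_orthant m).1.mono_set (SigmaN_subset_orthant m)

theorem setIntegral_SigmaN (m : ℕ) :
    ∫ μ in SigmaN m, VdM m μ ^ 2 * Real.exp (-(∑ j, μ j ^ 2) / 2) = Zn (2 * m) := by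
  have h := setIntegral_orthant_eq_factorial_mul
    (fun μ : Fin m → ℝ => VdM m μ ^ 2 * Real.exp (-(∑ j, μ j ^ 2) / 2))
    (fun x σ => by
      simp only [VdM_sq_comp_perm, Function.comp_apply, Equiv.sum_comp σ fun j => x j ^ 2])
    (fun x hx => by simp [VdM_eq_zero_of_not_injective hx])
    (integrableOn_and_setIntegral_orthant m).1
  rw [(integrableOn_and_setIntegral_orthant m).2] at h
  rw [← mul_left_cancel₀ (Nat.cast_ne_zero.2 m.factorial_ne_zero) h, Zn,
    Finset.prod_mul_distrib, Nat.mul_div_cancel_left _ two_pos,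
    Fin.prod_univ_eq_prod_range (fun j => ((2 * j).factorial : ℝ)) m, Finset.prod_const,
    Finset.card_univ, Fintype.card_fin, Real.sqrt_eq_rpow, ← Real.rpow_mul_natCast (by positivity)]
  congr 2
  push_cast
  ring

theorem VdM_sq_smul (m : ℕ) (r : ℝ) (μ : Fin m → ℝ) :
    VdM m (r • μ) ^ 2 = r ^ (2 * (m * (m - 1))) * VdM m μ ^ 2 := by
  have h : (Matrix.vandermonde fun i => (r • μ) i ^ 2) =
      Matrix.of fun i j : Fin m => (r ^ 2) ^ (j : ℕ) *
        Matrix.vandermonde (fun i => μ i ^ 2) i j := by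
    ext i j
    simp [Matrix.vandermonde_apply, mul_pow]
  rw [VdM_sq_eq_det_vandermonde_sq, VdM_sq_eq_det_vandermonde_sq, h, Matrix.det_mul_row, mul_pow,
    Fin.prod_univ_eq_prod_range (fun j => (r ^ 2) ^ j) m, Finset.prod_pow_eq_pow_sum, ← pow_mul,
    ← pow_mul, ← Finset.sum_range_id_mul_two]

open scoped Pointwise in
theorem smul_SigmaN (m : ℕ) {r : ℝ} (hr : 0 < r) : r • SigmaN m = SigmaN m := by
  ext x
  rw [Set.mem_smul_set_iff_inv_smul_mem₀ hr.ne']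
  simp [SigmaN, hr]

open scoped Pointwise in
theorem integrableOn_SigmaN_comp_smul (m : ℕ) {r : ℝ} (hr : 0 < r) {f : (Fin m → ℝ) → ℝ}
    (hf : IntegrableOn f (SigmaN m)) : IntegrableOn (fun x => f (r • x)) (SigmaN m) := by
  have hm := (isOpen_SigmaN m).measurableSet
  rw [← integrable_indicator_iff hm] at hf ⊢
  refine ((integrable_comp_smul_iff volume _ hr.ne').2 hf).congr (ae_of_all _ fun x => ?_)
  have hx : r • x ∈ SigmaN m ↔ x ∈ SigmaN m := by
    rw [← Set.smul_mem_smul_set_iff₀ hr.ne' (SigmaN m) x, smul_SigmaN m hr]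
  beta_reduce
  by_cases h : x ∈ SigmaN m
  · rw [Set.indicator_of_mem h, Set.indicator_of_mem (hx.2 h)]
  · rw [Set.indicator_of_notMem h, Set.indicator_of_notMem (mt hx.1 h)]

/-- Chernoff bound for the tails of the quadratic form `∑ μ_j²`. -/
theorem setIntegral_le_of_subset_SigmaN {m : ℕ} {c : ℝ} (hc : 0 < c) {T : Set (Fin m → ℝ)}
    (hT : MeasurableSet T) (hsub : T ⊆ SigmaN m)
    (hS : ∀ μ ∈ T, (c⁻¹ - 1) * ∑ j, μ j ^ 2 ≤ (1 - c) * ((m * (2 * m - 1) : ℕ) : ℝ)) :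
    ∫ μ in T, VdM m μ ^ 2 * Real.exp (-(∑ j, μ j ^ 2) / 2) ≤
      Zn (2 * m) * (c * Real.exp (1 - c)) ^ (((m * (2 * m - 1) : ℕ) : ℝ) / 2) := by
  set N := m * (2 * m - 1) with hN
  set G : (Fin m → ℝ) → ℝ := fun μ => VdM m μ ^ 2 * Real.exp (-(∑ j, μ j ^ 2) / 2) with hG
  set r := √c⁻¹ with hr_def
  have hr : 0 < r := Real.sqrt_pos.2 (inv_pos.2 hc)
  have hr2 : r ^ 2 = c⁻¹ := Real.sq_sqrt (inv_pos.2 hc).le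
  set K := Real.exp ((1 - c) * N / 2) * (r ^ (2 * (m * (m - 1))))⁻¹ with hK
  have hscaled : ∀ μ, K * G (r • μ) =
      VdM m μ ^ 2 * Real.exp ((1 - c) * N / 2 - c⁻¹ * (∑ j, μ j ^ 2) / 2) := by
    intro μ
    have hs : ∑ j, (r • μ) j ^ 2 = c⁻¹ * ∑ j, μ j ^ 2 := by
      simp only [Pi.smul_apply, smul_eq_mul, mul_pow, hr2, Finset.mul_sum]
    simp only [hG, hK]
    rw [VdM_sq_smul, hs, sub_eq_add_neg (_ / 2), Real.exp_add, ← neg_div]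
    field_simp
  have hint : IntegrableOn (fun μ => K * G (r • μ)) (SigmaN m) :=
    (integrableOn_SigmaN_comp_smul m hr (integrableOn_SigmaN m)).const_mul K
  have hpow : (r ^ m)⁻¹ * (r ^ (2 * (m * (m - 1))))⁻¹ = c ^ ((N : ℝ) / 2) := by
    have hexp : m + 2 * (m * (m - 1)) = N := by
      rcases m with _ | k
      · rfl
      · simp only [hN, Nat.add_sub_cancel, show 2 * (k + 1) - 1 = 2 * k + 1 by omega]
        ring
    rw [← mul_inv, ← pow_add, hexp, hr_def, Real.sqrt_inv, inv_pow, inv_inv, Real.sqrt_eq_rpow,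
      ← Real.rpow_mul_natCast hc.le]
    ring_nf
  calc ∫ μ in T, G μ ≤ ∫ μ in T, K * G (r • μ) := by
        refine setIntegral_mono_on ((integrableOn_SigmaN m).mono_set hsub) (hint.mono_set hsub) hT
          fun μ hμ => ?_
        rw [hscaled]
        refine mul_le_mul_of_nonneg_left (Real.exp_le_exp.2 ?_) (sq_nonneg _)
        linarith [hS μ hμ]
    _ ≤ ∫ μ in SigmaN m, K * G (r • μ) := by
        refine setIntegral_mono_set hint (ae_of_all _ fun μ => ?_) hsub.eventuallyLE
        simp only [hscaled, Pi.zero_apply]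
        positivity
    _ = Zn (2 * m) * (c * Real.exp (1 - c)) ^ ((N : ℝ) / 2) := by
        rw [integral_const_mul, Measure.setIntegral_comp_smul_of_pos _ _ _ hr, smul_SigmaN m hr,
          setIntegral_SigmaN, Module.finrank_fin_fun, smul_eq_mul,
          Real.mul_rpow hc.le (Real.exp_pos _).le, ← hpow, ← Real.exp_mul, hK, mul_div_assoc]
        ring

theorem stmt7 (n : ℕ) (hn : Even n) (hpos : 0 < n) (a b : ℝ) (ha : 0 < a) (ha1 : a < 1)
    (hb1 : 1 < b) :
    Zn n * (1 - (a * Real.exp (1 - a)) ^ (((n : ℝ) * ((n : ℝ) - 1)) / 4)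
              - (b * Real.exp (1 - b)) ^ (((n : ℝ) * ((n : ℝ) - 1)) / 4))
      ≤ ∫ μ in {μ ∈ SigmaN (n / 2) |
            a * (n.choose 2 : ℝ) < ∑ j, μ j ^ 2 ∧ ∑ j, μ j ^ 2 < b * (n.choose 2 : ℝ)},
          (VdM (n / 2) μ) ^ 2 * Real.exp (-(∑ j, μ j ^ 2) / 2) := by
  obtain ⟨m, rfl⟩ := even_iff_exists_two_mul.1 hn
  have hN : (2 * m).choose 2 = m * (2 * m - 1) := by
    rw [Nat.choose_two_right, mul_assoc, Nat.mul_div_cancel_left _ two_pos]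
  have hexp : ((2 * m : ℕ) : ℝ) * (((2 * m : ℕ) : ℝ) - 1) / 4 =
      ((m * (2 * m - 1) : ℕ) : ℝ) / 2 := by
    rw [Nat.cast_mul m, Nat.cast_sub (by omega)]
    push_cast
    ring
  rw [hN, hexp, Nat.mul_div_cancel_left _ two_pos]
  set N := ((m * (2 * m - 1) : ℕ) : ℝ)
  set U : Set (Fin m → ℝ) := {μ | a * N < ∑ j, μ j ^ 2}
  set V : Set (Fin m → ℝ) := {μ | ∑ j, μ j ^ 2 < b * N}
  have hU : MeasurableSet U := (isOpen_lt (by fun_prop) (by fun_prop)).measurableSet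
  have hV : MeasurableSet V := (isOpen_lt (by fun_prop) (by fun_prop)).measurableSet
  have hS := (isOpen_SigmaN m).measurableSet
  have hset : {μ ∈ SigmaN m | a * N < ∑ j, μ j ^ 2 ∧ ∑ j, μ j ^ 2 < b * N} =
      SigmaN m ∩ U ∩ V := by
    ext μ
    exact and_assoc.symm
  have h1 := integral_inter_add_sdiff hU (integrableOn_SigmaN m)
  have h2 := integral_inter_add_sdiff hV ((integrableOn_SigmaN m).mono_set
    (Set.inter_subset_left (t := U)))
  have hlow := setIntegral_le_of_subset_SigmaN ha (hS.diff hU) Set.sdiff_subset (by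
    rintro μ ⟨_, hμ⟩
    have hle : ∑ j, μ j ^ 2 ≤ a * N := not_lt.1 hμ
    have hinv : 0 ≤ a⁻¹ - 1 := sub_nonneg.2 ((one_le_inv₀ ha).2 ha1.le)
    calc (a⁻¹ - 1) * ∑ j, μ j ^ 2 ≤ (a⁻¹ - 1) * (a * N) := mul_le_mul_of_nonneg_left hle hinv
      _ = (1 - a) * N := by field_simp)
  have hb : 0 < b := one_pos.trans hb1
  have hhigh := setIntegral_le_of_subset_SigmaN hb ((hS.inter hU).diff hV)
    (Set.sdiff_subset.trans Set.inter_subset_left) (by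
    rintro μ ⟨_, hμ⟩
    have hle : b * N ≤ ∑ j, μ j ^ 2 := not_lt.1 hμ
    have hinv : b⁻¹ - 1 ≤ 0 := sub_nonpos.2 (inv_le_one_of_one_le₀ hb1.le)
    calc (b⁻¹ - 1) * ∑ j, μ j ^ 2 ≤ (b⁻¹ - 1) * (b * N) := mul_le_mul_of_nonpos_left hle hinv
      _ = (1 - b) * N := by field_simp)
  rw [setIntegral_SigmaN] at h1
  rw [hset]
  linarith
end
end
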